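/- arXiv:1808.07292 — 3 statements merged into one kernel-verified Lean document; each statement's English description precedes it below -/
import Mathlib

section
/- Let k ≥ 1 and define f : ℝ^k → ℝ by f(z) = (∑_{i=1}^k exp(z_i) z_i) / (∑_{j=1}^k exp(z_j)). Then for every z ∈ ℝ^k and every index i, the i-th partial derivative of f at z satisfies |∂f/∂z_i (z)| ≤ 1 + |z_i| + max_{j} |z_j|; in particular |∂f/∂z_i (z)| ≤ 1 + 2 max_j |z_j| = 1 + 2‖z‖_∞, so each partial derivative of f is bounded on every sup-norm ball. -/
open scoped BigOperators

theorem hasFDerivAt_sum_exp {ι : Type*} [Fintype ι] (z : ι → ℝ) :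
    HasFDerivAt (fun z : ι → ℝ => ∑ j, Real.exp (z j))
      (∑ j, Real.exp (z j) • ContinuousLinearMap.proj (R := ℝ) (φ := fun _ : ι => ℝ) j) z :=
  HasFDerivAt.fun_sum fun j _ => (hasFDerivAt_apply j z).exp

theorem hasFDerivAt_sum_exp_mul_self {ι : Type*} [Fintype ι] (z : ι → ℝ) :
    HasFDerivAt (fun z : ι → ℝ => ∑ j, Real.exp (z j) * z j)
      (∑ j, (Real.exp (z j) * (1 + z j)) •
        ContinuousLinearMap.proj (R := ℝ) (φ := fun _ : ι => ℝ) j) z := by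
  refine HasFDerivAt.fun_sum fun j _ => ?_
  refine ((hasFDerivAt_apply j z).exp.fun_mul (hasFDerivAt_apply j z)).congr_fderiv ?_
  module

theorem fderiv_softmax_weighted_mean_single {ι : Type*} [Fintype ι] [DecidableEq ι]
    (z : ι → ℝ) (i : ι) :
    fderiv ℝ (fun z : ι → ℝ => (∑ j, Real.exp (z j) * z j) / ∑ j, Real.exp (z j)) z
        (Pi.single i 1) =
      Real.exp (z i) / (∑ j, Real.exp (z j)) *
        (1 + z i - (∑ j, Real.exp (z j) * z j) / ∑ j, Real.exp (z j)) := by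
  have hS : ∑ j, Real.exp (z j) ≠ 0 :=
    (Finset.sum_pos (fun j _ => Real.exp_pos (z j)) ⟨i, Finset.mem_univ i⟩).ne'
  simp_rw [div_eq_mul_inv]
  refine (congrArg (fun L => L (Pi.single i 1)) ((hasFDerivAt_sum_exp_mul_self z).fun_mul
    ((hasDerivAt_inv hS).comp_hasFDerivAt z (hasFDerivAt_sum_exp z))).fderiv).trans ?_
  simp only [add_apply, smul_apply,
    sum_apply, ContinuousLinearMap.proj_apply, Pi.single_apply, smul_eq_mul,
    mul_ite, mul_one, mul_zero, Finset.sum_ite_eq', Finset.mem_univ, if_true,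
    Function.comp_apply]
  field_simp
  ring

theorem abs_softmax_weighted_mean_le {ι : Type*} [Fintype ι] [Nonempty ι] {z : ι → ℝ} {M : ℝ}
    (hM : ∀ j, |z j| ≤ M) :
    |(∑ j, Real.exp (z j) * z j) / ∑ j, Real.exp (z j)| ≤ M := by
  have hS : 0 < ∑ j, Real.exp (z j) :=
    Finset.sum_pos (fun j _ => Real.exp_pos (z j)) Finset.univ_nonempty
  rw [abs_div, abs_of_pos hS, div_le_iff₀ hS, Finset.mul_sum]
  refine (Finset.abs_sum_le_sum_abs _ _).trans (Finset.sum_le_sum fun j _ => ?_)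
  rw [abs_mul, Real.abs_exp, mul_comm]
  gcongr
  exact hM j

/-- Gradient bound of Theorem 1: each partial derivative of the softmax-weighted
mean `f` is bounded by `1 + |z i| + max_j |z j| ≤ 1 + 2 max_j |z j|`. -/
theorem softmax_weighted_mean_partial_deriv_bound
    (k : ℕ) (hk : 1 ≤ k)
    (f : (Fin k → ℝ) → ℝ)
    (hf : ∀ z, f z = (∑ i, Real.exp (z i) * z i) / (∑ j, Real.exp (z j))) :
    ∀ (z : Fin k → ℝ) (i : Fin k),
      |fderiv ℝ f z (Pi.single i 1)| ≤
          1 + |z i| + Finset.univ.sup' ⟨⟨0, hk⟩, Finset.mem_univ _⟩ (fun j => |z j|) ∧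
      |fderiv ℝ f z (Pi.single i 1)| ≤
          1 + 2 * Finset.univ.sup' ⟨⟨0, hk⟩, Finset.mem_univ _⟩ (fun j => |z j|) := by
  intro z i
  set M := Finset.univ.sup' ⟨⟨0, hk⟩, Finset.mem_univ _⟩ (fun j => |z j|)
  have hM : ∀ j, |z j| ≤ M := fun j => Finset.le_sup' (fun j => |z j|) (Finset.mem_univ j)
  have : Nonempty (Fin k) := ⟨i⟩
  have hmean := abs_softmax_weighted_mean_le hM
  have hS : 0 < ∑ j, Real.exp (z j) :=
    Finset.sum_pos (fun j _ => Real.exp_pos (z j)) Finset.univ_nonempty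
  have hweight : Real.exp (z i) / ∑ j, Real.exp (z j) ≤ 1 :=
    (div_le_one hS).2 <|
      Finset.single_le_sum (f := fun j => Real.exp (z j)) (fun j _ => (Real.exp_pos _).le)
        (Finset.mem_univ i)
  have hbound : |fderiv ℝ f z (Pi.single i 1)| ≤ 1 + |z i| + M := by
    rw [funext hf, fderiv_softmax_weighted_mean_single, abs_mul,
      abs_of_nonneg (div_nonneg (Real.exp_pos _).le hS.le)]
    refine (mul_le_of_le_one_left (abs_nonneg _) hweight).trans ((abs_sub _ _).trans ?_)
    gcongr
    exact (abs_add_le _ _).trans_eq (by rw [abs_one])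
  exact ⟨hbound, by linarith [hM i]⟩
end

section
/- Let k ≥ 1 and define f : ℝ^k → ℝ by f(z) = (∑_{i=1}^k exp(z_i) z_i) / (∑_{j=1}^k exp(z_j)). Then for every z ∈ ℝ^k, the Euclidean norm of the gradient of f at z satisfies ‖∇f(z)‖₂ ≤ √k · (1 + 2‖z‖_∞). Consequently, on the set {z ∈ ℝ^k : ‖z‖_∞ ≤ R} (for any R > 0) the gradient of f is bounded by ε = √k(1 + 2R). -/
open scoped BigOperators

/-- The weighted mean `∑ exp(z_i) z_i / ∑ exp(z_j)`. -/
noncomputable def softmaxMean {ι : Type*} [Fintype ι] (z : EuclideanSpace ℝ ι) : ℝ :=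
  (∑ i, Real.exp (z i) * z i) / ∑ j, Real.exp (z j)

section

variable {ι : Type*} [Fintype ι]

lemma sum_exp_pos [Nonempty ι] (z : ι → ℝ) : 0 < ∑ j, Real.exp (z j) :=
  Finset.sum_pos (fun _ _ => Real.exp_pos _) Finset.univ_nonempty

lemma abs_softmaxMean_le [Nonempty ι] {z : EuclideanSpace ℝ ι} {M : ℝ} (hM : ∀ j, |z j| ≤ M) :
    |softmaxMean z| ≤ M := by
  have hS := sum_exp_pos z
  rw [softmaxMean, abs_div, abs_of_pos hS, div_le_iff₀ hS, Finset.mul_sum]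
  refine (Finset.abs_sum_le_sum_abs _ _).trans (Finset.sum_le_sum fun i _ => ?_)
  rw [abs_mul, Real.abs_exp, mul_comm]
  exact mul_le_mul_of_nonneg_right (hM i) (Real.exp_pos _).le

lemma hasGradientAt_softmaxMean [Nonempty ι] (z : EuclideanSpace ℝ ι) :
    HasGradientAt softmaxMean
      (WithLp.toLp 2 fun j =>
        Real.exp (z j) / (∑ i, Real.exp (z i)) * (1 + z j - softmaxMean z)) z := by
  have hS := sum_exp_pos z
  have hproj (i : ι) : HasFDerivAt (fun w : EuclideanSpace ℝ ι => w i)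
      (EuclideanSpace.proj i : EuclideanSpace ℝ ι →L[ℝ] ℝ) z :=
    (EuclideanSpace.proj i : EuclideanSpace ℝ ι →L[ℝ] ℝ).hasFDerivAt
  have hden := HasFDerivAt.fun_sum (u := Finset.univ) fun i _ => (hproj i).exp
  have hnum := HasFDerivAt.fun_sum (u := Finset.univ) fun i _ => (hproj i).exp.mul (hproj i)
  rw [hasGradientAt_iff_hasFDerivAt]
  refine (hnum.mul ((hasDerivAt_inv hS.ne').comp_hasFDerivAt z hden)).congr_fderiv ?_
  ext v
  simp only [InnerProductSpace.toDual_apply_apply, PiLp.inner_apply, softmaxMean]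
  simp
  generalize ∑ i, Real.exp (z i) * z i = N
  generalize ∑ i, Real.exp (z i) = S at hS ⊢
  simp only [Finset.mul_sum, ← Finset.sum_neg_distrib, ← Finset.sum_add_distrib]
  refine Finset.sum_congr rfl fun i _ => ?_
  field_simp
  ring

lemma norm_gradient_softmaxMean_le [Nonempty ι] {z : EuclideanSpace ℝ ι} {M : ℝ}
    (hM : ∀ j, |z j| ≤ M) :
    ‖gradient softmaxMean z‖ ≤ Real.sqrt (Fintype.card ι) * (1 + 2 * M) := by
  have hS := sum_exp_pos z
  have hM0 : 0 ≤ M := (abs_nonneg _).trans (hM (Classical.arbitrary ι))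
  rw [(hasGradientAt_softmaxMean z).gradient, EuclideanSpace.norm_eq]
  refine Real.sqrt_le_iff.2 ⟨by positivity, ?_⟩
  rw [mul_pow, Real.sq_sqrt (Nat.cast_nonneg _), ← nsmul_eq_mul, Fintype.card]
  refine Finset.sum_le_card_nsmul _ _ _ fun j _ => ?_
  refine pow_le_pow_left₀ (norm_nonneg _) ?_ 2
  have hp : Real.exp (z j) / (∑ i, Real.exp (z i)) ≤ 1 := (div_le_one hS).2 <|
    Finset.single_le_sum (f := fun i => Real.exp (z i)) (fun _ _ => (Real.exp_pos _).le)
      (Finset.mem_univ j)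
  have hq : |1 + z j - softmaxMean z| ≤ 1 + 2 * M := by
    have h₁ := abs_le.1 (hM j)
    have h₂ := abs_le.1 (abs_softmaxMean_le hM)
    rw [abs_le]
    constructor <;> linarith
  rw [Real.norm_eq_abs, abs_mul, abs_of_pos (by positivity)]
  exact (mul_le_of_le_one_left (abs_nonneg _) hp).trans hq

end

/-- The Euclidean norm of the gradient of the softmax-weighted mean `f` satisfies
`‖∇f(z)‖₂ ≤ √k (1 + 2‖z‖_∞)`; consequently on `{z : ‖z‖_∞ ≤ R}` the gradient is
bounded by `√k (1 + 2R)`. -/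
theorem softmax_weighted_mean_gradient_bound
    (k : ℕ) (hk : 1 ≤ k)
    (f : EuclideanSpace ℝ (Fin k) → ℝ)
    (hf : ∀ z, f z = (∑ i, Real.exp (z i) * z i) / (∑ j, Real.exp (z j))) :
    (∀ z : EuclideanSpace ℝ (Fin k),
        ‖gradient f z‖ ≤
          Real.sqrt k *
            (1 + 2 * Finset.univ.sup' ⟨⟨0, hk⟩, Finset.mem_univ _⟩ (fun j => |z j|))) ∧
      ∀ R : ℝ, 0 < R → ∀ z : EuclideanSpace ℝ (Fin k),
        (∀ j, |z j| ≤ R) → ‖gradient f z‖ ≤ Real.sqrt k * (1 + 2 * R) := by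
  have : Nonempty (Fin k) := ⟨⟨0, hk⟩⟩
  obtain rfl : f = softmaxMean := funext hf
  have key (M : ℝ) (z : EuclideanSpace ℝ (Fin k)) (hM : ∀ j, |z j| ≤ M) :
      ‖gradient softmaxMean z‖ ≤ Real.sqrt k * (1 + 2 * M) := by
    simpa using norm_gradient_softmaxMean_le hM
  exact ⟨fun z => key _ z fun j => Finset.le_sup' (fun j => |z j|) (Finset.mem_univ j),
    fun R _ z hz => key R z hz⟩
end

section
/- (Theorem 2.) Let E be a real inner product space, let L : E → ℝ be a convex differentiable function whose gradient satisfies ‖∇L(x)‖ ≤ ε for all x ∈ E, and let x* ∈ E be a minimizer of L with L* = L(x*). Given positive step sizes η_1, …, η_T and the gradient-descent iterates x_{t+1} = x_t − η_t ∇L(x_t) started from x_1 ∈ E, the best objective value found within T steps, L*_T = min_{1 ≤ t ≤ T} L(x_t), satisfies L*_T − L* ≤ (‖x_1 − x*‖² + ε² ∑_{t=1}^T η_t²) / (2 ∑_{t=1}^T η_t). -/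
open scoped RealInnerProductSpace BigOperators

/-- One gradient step along a subgradient `g` of norm at most `ε` at `x`: the squared distance to
any point `z` drops by twice the step times `a`, up to the error `ε² η²`, as soon as
`a + ⟪g, z - x⟫ ≤ 0`. -/
theorem norm_sub_smul_sub_sq_add_le {E : Type*} [NormedAddCommGroup E] [InnerProductSpace ℝ E]
    {x z g : E} {ε η a : ℝ} (hη : 0 ≤ η) (hg : ‖g‖ ≤ ε) (ha : a + ⟪g, z - x⟫ ≤ 0) :
    ‖x - η • g - z‖ ^ 2 + 2 * (η * a) ≤ ‖x - z‖ ^ 2 + ε ^ 2 * η ^ 2 := by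
  have hexp : ‖x - η • g - z‖ ^ 2 = ‖x - z‖ ^ 2 + 2 * (η * ⟪g, z - x⟫) + ‖g‖ ^ 2 * η ^ 2 := by
    rw [sub_right_comm, norm_sub_sq_real, real_inner_smul_right, norm_smul, mul_pow,
      Real.norm_eq_abs, sq_abs, real_inner_comm, ← neg_sub z x, inner_neg_right]
    ring
  have hsq : ‖g‖ ^ 2 * η ^ 2 ≤ ε ^ 2 * η ^ 2 := by gcongr
  have hmul : η * (a + ⟪g, z - x⟫) ≤ 0 := mul_nonpos_of_nonneg_of_nonpos hη ha
  linarith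

/-- Summing the one-step estimate over the first `n` steps of gradient descent. -/
theorem norm_sub_sq_add_two_mul_sum_le {E : Type*} [NormedAddCommGroup E]
    [InnerProductSpace ℝ E] [CompleteSpace E] {L : E → ℝ} {ε : ℝ}
    (hconv : ∀ x y : E, L x + ⟪gradient L x, y - x⟫ ≤ L y)
    (hgrad : ∀ x : E, ‖gradient L x‖ ≤ ε) (z : E) {η : ℕ → ℝ} (hη : ∀ t, 0 ≤ η t)
    {x : ℕ → E} (hx : ∀ t, x (t + 1) = x t - η t • gradient L (x t)) (n : ℕ) :
    ‖x n - z‖ ^ 2 + 2 * ∑ t ∈ Finset.range n, η t * (L (x t) - L z) ≤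
      ‖x 0 - z‖ ^ 2 + ε ^ 2 * ∑ t ∈ Finset.range n, η t ^ 2 := by
  induction n with
  | zero => simp
  | succ n ih =>
    have hstep := norm_sub_smul_sub_sq_add_le (hη n) (hgrad (x n))
      (show L (x n) - L z + ⟪gradient L (x n), z - x n⟫ ≤ 0 by linarith [hconv (x n) z])
    rw [Finset.sum_range_succ, Finset.sum_range_succ, hx n]
    linarith

/-- Theorem 2 of the paper: for gradient descent on a convex differentiable `L`
with bounded gradient `‖∇L‖ ≤ ε` and minimizer `x*`, the best loss found within
`T` steps satisfies
`L*_T - L* ≤ (‖x 1 - x*‖² + ε² ∑ η t²) / (2 ∑ η t)`. -/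
theorem sgd_best_iterate_convergence
    {E : Type*} [NormedAddCommGroup E] [InnerProductSpace ℝ E] [CompleteSpace E]
    (L : E → ℝ) (hL : Differentiable ℝ L) (ε : ℝ)
    (hconv : ∀ x y : E, L x + ⟪gradient L x, y - x⟫ ≤ L y)
    (hgrad : ∀ x : E, ‖gradient L x‖ ≤ ε)
    (xs : E) (hmin : ∀ y : E, L xs ≤ L y)
    (T : ℕ) (hT : 0 < T) (η : ℕ → ℝ) (hη : ∀ t, 0 < η t)
    (x : ℕ → E) (hx : ∀ t, x (t + 1) = x t - η t • gradient L (x t)) :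
    (Finset.range T).inf' (Finset.nonempty_range_iff.mpr hT.ne')
        (fun t => L (x t)) - L xs ≤
      (‖x 0 - xs‖ ^ 2 + ε ^ 2 * ∑ t ∈ Finset.range T, η t ^ 2) /
        (2 * ∑ t ∈ Finset.range T, η t) := by
  have hsum : 0 < ∑ t ∈ Finset.range T, η t :=
    Finset.sum_pos (fun t _ => hη t) (Finset.nonempty_range_iff.mpr hT.ne')
  rw [le_div_iff₀ (by positivity)]
  set m := (Finset.range T).inf' (Finset.nonempty_range_iff.mpr hT.ne') (fun t => L (x t))
  have hbest : (∑ t ∈ Finset.range T, η t) * (m - L xs) ≤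
      ∑ t ∈ Finset.range T, η t * (L (x t) - L xs) := by
    rw [Finset.sum_mul]
    refine Finset.sum_le_sum fun t ht => mul_le_mul_of_nonneg_left ?_ (hη t).le
    exact sub_le_sub_right (Finset.inf'_le (fun t => L (x t)) ht) _
  have htel := norm_sub_sq_add_two_mul_sum_le hconv hgrad xs (fun t => (hη t).le) hx T
  linarith [sq_nonneg ‖x T - xs‖]
end
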